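/- Let W be a weak Hopf algebra. The linear span J in W^{cop-dual}⊗W of the elements φ⊗xh − φ(x⇀ε)⊗h (x ∈ W_L) and φ⊗yh − φ(ε↼y)⊗h (y ∈ W_R) is a two-sided ideal of the algebra Ŵ^{cop}⊗W with multiplication (φ⊗h)(ψ⊗g) = Σ φψ⁽²⁾ ⊗ h⁽²⁾g ⟨ψ⁽¹⁾, S⁻¹(h⁽³⁾)⟩⟨ψ⁽³⁾, h⁽¹⁾⟩. -/

import Mathlib

open TensorProduct

/-- A weak Hopf algebra over a commutative ring `R`: an `R`-algebra `W` together with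
a coalgebra structure `(comul, counit)` which is multiplicative but only weakly unital
and counital, and an antipode `S` satisfying the weak Hopf axioms
`μ∘(id⊗S)∘Δ = ε_L`, `μ∘(S⊗id)∘Δ = ε_R` and `S(h) = Σ S(h⁽¹⁾)h⁽²⁾S(h⁽³⁾)`,
where `ε_L(h) = (ε⊗id)(Δ(1)(h⊗1))` and `ε_R(h) = (id⊗ε)((1⊗h)Δ(1))`. -/
structure WeakHopf (R : Type*) (W : Type*) [CommRing R] [Ring W] [Algebra R W] where
  comul : W →ₗ[R] W ⊗[R] W
  counit : W →ₗ[R] R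
  antipode : W →ₗ[R] W
  coassoc :
    (TensorProduct.assoc R W W W).toLinearMap ∘ₗ comul.rTensor W ∘ₗ comul
      = comul.lTensor W ∘ₗ comul
  counit_comul_left :
    (TensorProduct.lid R W).toLinearMap ∘ₗ counit.rTensor W ∘ₗ comul = LinearMap.id
  counit_comul_right :
    (TensorProduct.rid R W).toLinearMap ∘ₗ counit.lTensor W ∘ₗ comul = LinearMap.id
  comul_mul : ∀ u v : W, comul (u * v) = comul u * comul v
  weak_counit_mul : ∀ u v w : W,
    counit (u * v * w)
      = LinearMap.mul' R R
          ((TensorProduct.map (counit ∘ₗ LinearMap.mulLeft R u)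
            (counit ∘ₗ LinearMap.mulRight R w)) (comul v))
  weak_counit_mul' : ∀ u v w : W,
    counit (u * v * w)
      = LinearMap.mul' R R
          ((TensorProduct.map (counit ∘ₗ LinearMap.mulLeft R u)
            (counit ∘ₗ LinearMap.mulRight R w)) ((TensorProduct.comm R W W) (comul v)))
  weak_comul_one :
    (comul.rTensor W) (comul 1)
      = (comul 1 ⊗ₜ[R] (1 : W))
          * ((TensorProduct.assoc R W W W).symm ((1 : W) ⊗ₜ[R] comul 1))
  weak_comul_one' :
    (comul.rTensor W) (comul 1)
      = ((TensorProduct.assoc R W W W).symm ((1 : W) ⊗ₜ[R] comul 1))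
          * (comul 1 ⊗ₜ[R] (1 : W))
  antipode_left : ∀ h : W,
    LinearMap.mul' R W ((antipode.lTensor W) (comul h))
      = (TensorProduct.lid R W) ((counit.rTensor W) (comul 1 * (h ⊗ₜ[R] (1 : W))))
  antipode_right : ∀ h : W,
    LinearMap.mul' R W ((antipode.rTensor W) (comul h))
      = (TensorProduct.rid R W) ((counit.lTensor W) (((1 : W) ⊗ₜ[R] h) * comul 1))
  antipode_mid : ∀ h : W,
    antipode h
      = LinearMap.mul' R W ((LinearMap.rTensor W (LinearMap.mul' R W))
          ((TensorProduct.map (TensorProduct.map antipode LinearMap.id) antipode)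
            ((comul.rTensor W) (comul h))))

namespace WeakHopf

variable {R : Type*} {W : Type*} [CommRing R] [Ring W] [Algebra R W]

/-- The left counital map `ε_L(h) = (ε⊗id)(Δ(1)(h⊗1)) = Σ ε(1⁽¹⁾h)1⁽²⁾`. -/
noncomputable def epsL (H : WeakHopf R W) : W →ₗ[R] W :=
  (TensorProduct.lid R W).toLinearMap ∘ₗ H.counit.rTensor W ∘ₗ
    LinearMap.mulLeft R (H.comul 1) ∘ₗ (TensorProduct.mk R W W).flip 1

/-- The right counital map `ε_R(h) = (id⊗ε)((1⊗h)Δ(1)) = Σ 1⁽¹⁾ε(h1⁽²⁾)`. -/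
noncomputable def epsR (H : WeakHopf R W) : W →ₗ[R] W :=
  (TensorProduct.rid R W).toLinearMap ∘ₗ H.counit.lTensor W ∘ₗ
    LinearMap.mulRight R (H.comul 1) ∘ₗ TensorProduct.mk R W W 1

/-- A left integral: `x·l = ε_L(x)·l` for all `x`. -/
def IsLeftIntegral (H : WeakHopf R W) (l : W) : Prop := ∀ x : W, x * l = H.epsL x * l

/-- A right integral: `r·x = r·ε_R(x)` for all `x`. -/
def IsRightIntegral (H : WeakHopf R W) (r : W) : Prop := ∀ x : W, r * x = r * H.epsR x

/-- A Haar integral: a two-sided integral which is two-sided normalized. -/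
def IsHaar (H : WeakHopf R W) (h : W) : Prop :=
  H.IsLeftIntegral h ∧ H.IsRightIntegral h ∧ H.epsL h = 1 ∧ H.epsR h = 1

end WeakHopf

/-! ## The quantum double `D(W)` in operator form

For a finite-dimensional weak Hopf algebra `W` over a field, the vector space
`Ŵ^{cop} ⊗ W` is canonically identified with `End(W) = W →ₗ[k] W` via
`φ ⊗ h ↦ (x ↦ φ(x)·h)` (a rank-one operator).  Under this identification the
multiplication
`(φ⊗h)(ψ⊗g) = Σ_{(h),(ψ)} φψ⁽²⁾ ⊗ h⁽²⁾g ⟨ψ⁽¹⁾, S⁻¹(h⁽³⁾)⟩⟨ψ⁽³⁾, h⁽¹⁾⟩`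
becomes (using `Σ_{(ψ)} ψ⁽¹⁾(a)ψ⁽²⁾(x)ψ⁽³⁾(c) = ψ(a·x·c)`, the dual coproduct being
dual to the multiplication of `W`) the operator product
`(F•G)(x) = Σ_{(x)} Σ_{(F(x⁽¹⁾))} F(x⁽¹⁾)⁽²⁾ · G(S⁻¹(F(x⁽¹⁾)⁽³⁾) · x⁽²⁾ · F(x⁽¹⁾)⁽¹⁾)`,
which is `mulD` below.  The quantum double `D(W)` is the quotient of this algebra by
the two-sided ideal `J` (`Jideal` below). -/

namespace WeakHopf

variable {k : Type*} {W : Type*} [Field k] [Ring W] [Algebra k W]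

/-- The rank-one operator `φ ⊗ h : x ↦ φ(x)·h`, representing the element `φ ⊗ h` of
`Ŵ^{cop} ⊗ W`. -/
noncomputable def rkOne (φ : Module.Dual k W) (h : W) : W →ₗ[k] W := φ.smulRight h

/-- The multiplication of `Ŵ^{cop} ⊗ W` in operator form (see the module docstring). -/
noncomputable def mulD (H : WeakHopf k W) (Sinv : W →ₗ[k] W) (F G : W →ₗ[k] W) :
    W →ₗ[k] W :=
  LinearMap.mul' k W
  ∘ₗ LinearMap.lTensor W
      (G ∘ₗ LinearMap.mul' k W ∘ₗ LinearMap.rTensor W (LinearMap.mul' k W))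
  ∘ₗ (TensorProduct.comm k ((W ⊗[k] W) ⊗[k] W) W).toLinearMap
  ∘ₗ (TensorProduct.assoc k (W ⊗[k] W) W W).symm.toLinearMap
  ∘ₗ (TensorProduct.comm k (W ⊗[k] W) (W ⊗[k] W)).toLinearMap
  ∘ₗ (TensorProduct.assoc k (W ⊗[k] W) W W).toLinearMap
  ∘ₗ LinearMap.rTensor W
      (LinearMap.lTensor (W ⊗[k] W) Sinv ∘ₗ LinearMap.rTensor W H.comul ∘ₗ H.comul ∘ₗ F)
  ∘ₗ H.comul

/-- The unit `[ε ⊗ 1_W]` of `Ŵ^{cop} ⊗ W`. -/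
noncomputable def unitD (H : WeakHopf k W) : W →ₗ[k] W := rkOne H.counit 1

/-- The convolution multiplication on `Ŵ`: `(φψ)(x) = Σ φ(x⁽¹⁾)ψ(x⁽²⁾)`. -/
noncomputable def cmul (H : WeakHopf k W) (φ ψ : Module.Dual k W) : Module.Dual k W :=
  LinearMap.mul' k k ∘ₗ TensorProduct.map φ ψ ∘ₗ H.comul

/-- The generators of the ideal `J`:
`φ ⊗ xh − φ·(x⇀ε) ⊗ h` for `x ∈ W_L`, and `φ ⊗ yh − φ·(ε↼y) ⊗ h` for `y ∈ W_R`,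
where `(x⇀ε)(w) = ε(wx)` and `(ε↼y)(w) = ε(yw)`. -/
noncomputable def Jgen (H : WeakHopf k W) : Set (W →ₗ[k] W) :=
  {F | ∃ φ : Module.Dual k W, ∃ x h : W, x ∈ Set.range ⇑H.epsL ∧
      F = rkOne φ (x * h)
            - rkOne (H.cmul φ (H.counit ∘ₗ LinearMap.mulRight k x)) h}
  ∪ {F | ∃ φ : Module.Dual k W, ∃ y h : W, y ∈ Set.range ⇑H.epsR ∧
      F = rkOne φ (y * h)
            - rkOne (H.cmul φ (H.counit ∘ₗ LinearMap.mulLeft k y)) h}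

/-- The linear span `J` of the generators `Jgen`. -/
noncomputable def Jideal (H : WeakHopf k W) : Submodule k (W →ₗ[k] W) :=
  Submodule.span k (Jgen H)

end WeakHopf

namespace WeakHopf

section General

variable {R : Type*} {W : Type*} [CommRing R] [Ring W] [Algebra R W]

/-- The slice map `a ⊗ b ↦ f(a)·b`. -/
noncomputable def sliceL (f : Module.Dual R W) : W ⊗[R] W →ₗ[R] W :=
  (TensorProduct.lid R W).toLinearMap ∘ₗ f.rTensor W

/-- The slice map `a ⊗ b ↦ f(b)·a`. -/
noncomputable def sliceR (f : Module.Dual R W) : W ⊗[R] W →ₗ[R] W :=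
  (TensorProduct.rid R W).toLinearMap ∘ₗ f.lTensor W

@[simp] lemma sliceL_tmul (f : Module.Dual R W) (a b : W) : sliceL f (a ⊗ₜ b) = f a • b := by
  simp [sliceL]

@[simp] lemma sliceR_tmul (f : Module.Dual R W) (a b : W) : sliceR f (a ⊗ₜ b) = f b • a := by
  simp [sliceR]

/-- Membership in the left counital subalgebra, described by slices of `Δ(1)`. -/
def IsCounitalL (H : WeakHopf R W) (x : W) : Prop := ∃ f, x = sliceL f (H.comul 1)

/-- Membership in the right counital subalgebra, described by slices of `Δ(1)`. -/
def IsCounitalR (H : WeakHopf R W) (y : W) : Prop := ∃ f, y = sliceR f (H.comul 1)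

variable (H : WeakHopf R W)

lemma epsL_apply (h : W) :
    H.epsL h = sliceL (H.counit ∘ₗ LinearMap.mulRight R h) (H.comul 1) := by
  have key : ∀ t : W ⊗[R] W, (TensorProduct.lid R W) ((H.counit.rTensor W) (t * (h ⊗ₜ 1)))
      = sliceL (H.counit ∘ₗ LinearMap.mulRight R h) t := by
    intro t
    induction t using TensorProduct.induction_on with
    | zero => simp
    | tmul a b => simp
    | add a b ha hb => simp only [add_mul, map_add, ha, hb]
  exact key _

lemma epsR_apply (h : W) :
    H.epsR h = sliceR (H.counit ∘ₗ LinearMap.mulLeft R h) (H.comul 1) := by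
  have key : ∀ t : W ⊗[R] W, (TensorProduct.rid R W) ((H.counit.lTensor W) ((1 ⊗ₜ h) * t))
      = sliceR (H.counit ∘ₗ LinearMap.mulLeft R h) t := by
    intro t
    induction t using TensorProduct.induction_on with
    | zero => simp
    | tmul a b => simp
    | add a b ha hb => simp only [mul_add, map_add, ha, hb]
  exact key _

lemma isCounitalL_epsL (h : W) : H.IsCounitalL (H.epsL h) := ⟨_, H.epsL_apply h⟩

lemma isCounitalR_epsR (h : W) : H.IsCounitalR (H.epsR h) := ⟨_, H.epsR_apply h⟩

lemma comul_one_mul (u : W) : H.comul 1 * H.comul u = H.comul u := by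
  rw [← H.comul_mul, one_mul]

lemma comul_mul_one (u : W) : H.comul u * H.comul 1 = H.comul u := by
  rw [← H.comul_mul, mul_one]

lemma coassoc_apply (u : W) :
    (TensorProduct.assoc R W W W) (H.comul.rTensor W (H.comul u))
      = H.comul.lTensor W (H.comul u) :=
  LinearMap.congr_fun H.coassoc u

lemma sliceL_counit_comul (u : W) : sliceL H.counit (H.comul u) = u :=
  LinearMap.congr_fun H.counit_comul_left u

lemma sliceR_counit_comul (u : W) : sliceR H.counit (H.comul u) = u :=
  LinearMap.congr_fun H.counit_comul_right u

lemma assoc_mul (p q : (W ⊗[R] W) ⊗[R] W) :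
    TensorProduct.assoc R W W W (p * q)
      = TensorProduct.assoc R W W W p * TensorProduct.assoc R W W W q :=
  map_mul (Algebra.TensorProduct.assoc R R R W W W) p q

lemma lTensor_comul_comul_one :
    H.comul.lTensor W (H.comul 1)
      = TensorProduct.assoc R W W W (H.comul 1 ⊗ₜ 1) * ((1 : W) ⊗ₜ H.comul 1) := by
  rw [← coassoc_apply, weak_comul_one, assoc_mul, LinearEquiv.apply_symm_apply]

lemma lTensor_comul_comul_one' :
    H.comul.lTensor W (H.comul 1)
      = ((1 : W) ⊗ₜ H.comul 1) * TensorProduct.assoc R W W W (H.comul 1 ⊗ₜ 1) := by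
  rw [← coassoc_apply, weak_comul_one', assoc_mul, LinearEquiv.apply_symm_apply]

/-- The slice map `a ⊗ (b ⊗ c) ↦ f(a)·(b ⊗ c)`. -/
noncomputable def sliceL₂ (f : Module.Dual R W) : W ⊗[R] (W ⊗[R] W) →ₗ[R] W ⊗[R] W :=
  (TensorProduct.lid R (W ⊗[R] W)).toLinearMap ∘ₗ f.rTensor (W ⊗[R] W)

/-- The slice map `(a ⊗ b) ⊗ c ↦ f(c)·(a ⊗ b)`. -/
noncomputable def sliceR₂ (f : Module.Dual R W) : (W ⊗[R] W) ⊗[R] W →ₗ[R] W ⊗[R] W :=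
  (TensorProduct.rid R (W ⊗[R] W)).toLinearMap ∘ₗ f.lTensor (W ⊗[R] W)

@[simp] lemma sliceL₂_tmul (f : Module.Dual R W) (a : W) (t : W ⊗[R] W) :
    sliceL₂ f (a ⊗ₜ t) = f a • t := by
  simp [sliceL₂]

@[simp] lemma sliceR₂_tmul (f : Module.Dual R W) (t : W ⊗[R] W) (c : W) :
    sliceR₂ f (t ⊗ₜ c) = f c • t := by
  simp [sliceR₂]

lemma sliceL₂_lTensor (f : Module.Dual R W) (g : W →ₗ[R] W ⊗[R] W) (t : W ⊗[R] W) :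
    sliceL₂ f (g.lTensor W t) = g (sliceL f t) := by
  induction t using TensorProduct.induction_on with
  | zero => simp
  | tmul a b => simp
  | add a b ha hb => simp only [map_add, ha, hb]

lemma sliceR₂_rTensor (f : Module.Dual R W) (g : W →ₗ[R] W ⊗[R] W) (t : W ⊗[R] W) :
    sliceR₂ f (g.rTensor W t) = g (sliceR f t) := by
  induction t using TensorProduct.induction_on with
  | zero => simp
  | tmul a b => simp
  | add a b ha hb => simp only [map_add, ha, hb]

lemma sliceL₂_assoc_mul (f : Module.Dual R W) (t s : W ⊗[R] W) :
    sliceL₂ f (TensorProduct.assoc R W W W (t ⊗ₜ 1) * (1 ⊗ₜ s)) = (sliceL f t ⊗ₜ 1) * s := by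
  induction t using TensorProduct.induction_on with
  | zero => simp
  | tmul a b => simp [← TensorProduct.smul_tmul']
  | add a b ha hb => simp only [TensorProduct.add_tmul, add_mul, map_add, ha, hb]

lemma sliceL₂_mul_assoc (f : Module.Dual R W) (t s : W ⊗[R] W) :
    sliceL₂ f ((1 ⊗ₜ s) * TensorProduct.assoc R W W W (t ⊗ₜ 1)) = s * (sliceL f t ⊗ₜ 1) := by
  induction t using TensorProduct.induction_on with
  | zero => simp
  | tmul a b => simp [← TensorProduct.smul_tmul']
  | add a b ha hb => simp only [TensorProduct.add_tmul, mul_add, map_add, ha, hb]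

lemma sliceR₂_assoc_mul (f : Module.Dual R W) (t s : W ⊗[R] W) :
    sliceR₂ f ((TensorProduct.assoc R W W W).symm (1 ⊗ₜ t) * (s ⊗ₜ 1))
      = (1 ⊗ₜ sliceR f t) * s := by
  induction t using TensorProduct.induction_on with
  | zero => simp
  | tmul a b => simp
  | add a b ha hb => simp only [TensorProduct.tmul_add, add_mul, map_add, ha, hb]

lemma sliceR₂_mul_assoc (f : Module.Dual R W) (t s : W ⊗[R] W) :
    sliceR₂ f ((s ⊗ₜ 1) * (TensorProduct.assoc R W W W).symm (1 ⊗ₜ t))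
      = s * (1 ⊗ₜ sliceR f t) := by
  induction t using TensorProduct.induction_on with
  | zero => simp
  | tmul a b => simp
  | add a b ha hb => simp only [TensorProduct.tmul_add, mul_add, map_add, ha, hb]

variable {H} {x y : W}

lemma IsCounitalL.comul_eq (hx : H.IsCounitalL x) : H.comul x = (x ⊗ₜ 1) * H.comul 1 := by
  obtain ⟨f, rfl⟩ := hx
  rw [← sliceL₂_lTensor, lTensor_comul_comul_one, sliceL₂_assoc_mul]

lemma IsCounitalL.comul_eq' (hx : H.IsCounitalL x) : H.comul x = H.comul 1 * (x ⊗ₜ 1) := by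
  obtain ⟨f, rfl⟩ := hx
  rw [← sliceL₂_lTensor, lTensor_comul_comul_one', sliceL₂_mul_assoc]

lemma IsCounitalR.comul_eq (hy : H.IsCounitalR y) : H.comul y = (1 ⊗ₜ y) * H.comul 1 := by
  obtain ⟨f, rfl⟩ := hy
  rw [← sliceR₂_rTensor, weak_comul_one', sliceR₂_assoc_mul]

lemma IsCounitalR.comul_eq' (hy : H.IsCounitalR y) : H.comul y = H.comul 1 * (1 ⊗ₜ y) := by
  obtain ⟨f, rfl⟩ := hy
  rw [← sliceR₂_rTensor, weak_comul_one, sliceR₂_mul_assoc]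

lemma IsCounitalL.comul_mul_left (hx : H.IsCounitalL x) (u : W) :
    H.comul (x * u) = (x ⊗ₜ 1) * H.comul u := by
  rw [H.comul_mul, hx.comul_eq, mul_assoc, comul_one_mul]

lemma IsCounitalL.comul_mul_right (hx : H.IsCounitalL x) (u : W) :
    H.comul (u * x) = H.comul u * (x ⊗ₜ 1) := by
  rw [H.comul_mul, hx.comul_eq', ← mul_assoc, comul_mul_one]

lemma IsCounitalR.comul_mul_left (hy : H.IsCounitalR y) (u : W) :
    H.comul (y * u) = (1 ⊗ₜ y) * H.comul u := by
  rw [H.comul_mul, hy.comul_eq, mul_assoc, comul_one_mul]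

lemma IsCounitalR.comul_mul_right (hy : H.IsCounitalR y) (u : W) :
    H.comul (u * y) = H.comul u * (1 ⊗ₜ y) := by
  rw [H.comul_mul, hy.comul_eq', ← mul_assoc, comul_mul_one]

lemma IsCounitalL.commute (hx : H.IsCounitalL x) (hy : H.IsCounitalR y) : x * y = y * x := by
  obtain ⟨f, rfl⟩ := hx
  obtain ⟨g, rfl⟩ := hy
  have key : ∀ t s : W ⊗[R] W,
      sliceR g (sliceL₂ f (TensorProduct.assoc R W W W (t ⊗ₜ 1) * (1 ⊗ₜ s)))
        = sliceL f t * sliceR g s ∧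
      sliceR g (sliceL₂ f ((1 ⊗ₜ s) * TensorProduct.assoc R W W W (t ⊗ₜ 1)))
        = sliceR g s * sliceL f t := by
    intro t s
    rw [sliceL₂_assoc_mul, sliceL₂_mul_assoc]
    induction s using TensorProduct.induction_on with
    | zero => simp
    | tmul a b => simp
    | add a b ha hb => simp only [mul_add, add_mul, map_add, ha.1, hb.1, ha.2, hb.2, and_self]
  rw [← (key _ _).1, ← (key _ _).2, ← lTensor_comul_comul_one, ← lTensor_comul_comul_one']

lemma IsCounitalL.epsL_mul (hx : H.IsCounitalL x) (u : W) : H.epsL (x * u) = x * H.epsL u := by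
  have e : ∀ v, H.epsL v = LinearMap.mul' R W ((H.antipode.lTensor W) (H.comul v)) :=
    fun v => (H.antipode_left v).symm
  rw [e, e, hx.comul_mul_left]
  induction H.comul u using TensorProduct.induction_on with
  | zero => simp
  | tmul a b => simp [mul_assoc]
  | add a b ha hb => simp only [mul_add, map_add, ha, hb]

lemma IsCounitalR.epsR_mul (hy : H.IsCounitalR y) (u : W) : H.epsR (u * y) = H.epsR u * y := by
  have e : ∀ v, H.epsR v = LinearMap.mul' R W ((H.antipode.rTensor W) (H.comul v)) :=
    fun v => (H.antipode_right v).symm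
  rw [e, e, hy.comul_mul_right]
  induction H.comul u using TensorProduct.induction_on with
  | zero => simp
  | tmul a b => simp [mul_assoc]
  | add a b ha hb => simp only [add_mul, map_add, ha, hb]

variable (H)

lemma counit_mul_sliceR (g h : W) :
    H.counit (g * sliceR (H.counit ∘ₗ LinearMap.mulRight R h) (H.comul 1))
      = H.counit (g * h) := by
  have e := H.weak_counit_mul g 1 h
  rw [mul_one] at e
  rw [e]
  induction H.comul 1 using TensorProduct.induction_on with
  | zero => simp
  | tmul a b => simp [mul_comm]
  | add a b ha hb => simp only [mul_add, map_add, ha, hb]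

lemma counit_sliceL_mul (g h : W) :
    H.counit (sliceL (H.counit ∘ₗ LinearMap.mulLeft R g) (H.comul 1) * h)
      = H.counit (g * h) := by
  have e := H.weak_counit_mul g 1 h
  rw [mul_one] at e
  rw [e]
  induction H.comul 1 using TensorProduct.induction_on with
  | zero => simp
  | tmul a b => simp
  | add a b ha hb => simp only [add_mul, map_add, ha, hb]

lemma counit_mul_epsL (g h : W) : H.counit (g * H.epsL h) = H.counit (g * h) := by
  have e := H.weak_counit_mul' g 1 h
  rw [mul_one] at e
  rw [epsL_apply, e]
  induction H.comul 1 using TensorProduct.induction_on with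
  | zero => simp
  | tmul a b => simp [mul_comm]
  | add a b ha hb => simp only [mul_add, map_add, ha, hb]

lemma counit_epsR_mul (g h : W) : H.counit (H.epsR g * h) = H.counit (g * h) := by
  have e := H.weak_counit_mul' g 1 h
  rw [mul_one] at e
  rw [epsR_apply, e]
  induction H.comul 1 using TensorProduct.induction_on with
  | zero => simp
  | tmul a b => simp
  | add a b ha hb => simp only [add_mul, map_add, ha, hb]

/-- `ε_L` depends only on the functional `w ↦ ε(wh)`. -/
lemma epsL_congr {g h : W} (e : ∀ w, H.counit (w * g) = H.counit (w * h)) :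
    H.epsL g = H.epsL h := by
  rw [epsL_apply, epsL_apply]
  congr 2
  ext w
  exact e w

/-- `ε_R` depends only on the functional `w ↦ ε(hw)`. -/
lemma epsR_congr {g h : W} (e : ∀ w, H.counit (g * w) = H.counit (h * w)) :
    H.epsR g = H.epsR h := by
  rw [epsR_apply, epsR_apply]
  congr 2
  ext w
  exact e w

lemma exists_epsL_eq (h : W) : ∃ y, H.IsCounitalR y ∧ H.epsL y = H.epsL h :=
  ⟨_, ⟨_, rfl⟩, H.epsL_congr fun w => H.counit_mul_sliceR w h⟩

lemma exists_epsR_eq (h : W) : ∃ x, H.IsCounitalL x ∧ H.epsR x = H.epsR h :=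
  ⟨_, ⟨_, rfl⟩, H.epsR_congr fun w => H.counit_sliceL_mul h w⟩

variable {H}

lemma IsCounitalR.epsL_mul (hy : H.IsCounitalR y) (h : W) :
    H.epsL (y * h) = H.epsL h * H.epsL y := by
  rw [← (H.isCounitalL_epsL h).epsL_mul, (H.isCounitalL_epsL h).commute hy]
  exact H.epsL_congr fun w => by rw [← mul_assoc, ← mul_assoc, counit_mul_epsL]

lemma IsCounitalL.epsR_mul (hx : H.IsCounitalL x) (h : W) :
    H.epsR (h * x) = H.epsR x * H.epsR h := by
  rw [← (H.isCounitalR_epsR h).epsR_mul, hx.commute (H.isCounitalR_epsR h)]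
  exact H.epsR_congr fun w => by rw [mul_assoc, mul_assoc, counit_epsR_mul]

variable (H)

lemma antipode_eq_epsR (h : W) :
    H.antipode h = LinearMap.mul' R W (TensorProduct.map H.epsR H.antipode (H.comul h)) := by
  have e : ∀ v, H.epsR v = LinearMap.mul' R W ((H.antipode.rTensor W) (H.comul v)) :=
    fun v => (H.antipode_right v).symm
  rw [H.antipode_mid]
  congr 1
  induction H.comul h using TensorProduct.induction_on with
  | zero => simp
  | tmul a b => simp [e, LinearMap.rTensor]
  | add a b ha hb => simp only [map_add, ha, hb]

lemma antipode_eq_epsL (h : W) :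
    H.antipode h = LinearMap.mul' R W (TensorProduct.map H.antipode H.epsL (H.comul h)) := by
  have e : ∀ v, H.epsL v = LinearMap.mul' R W ((H.antipode.lTensor W) (H.comul v)) :=
    fun v => (H.antipode_left v).symm
  rw [H.antipode_mid]
  have key : ∀ p : (W ⊗[R] W) ⊗[R] W,
      LinearMap.mul' R W ((LinearMap.rTensor W (LinearMap.mul' R W))
          ((TensorProduct.map (TensorProduct.map H.antipode LinearMap.id) H.antipode) p))
        = LinearMap.mul' R W (TensorProduct.map H.antipode
            (LinearMap.mul' R W ∘ₗ H.antipode.lTensor W) (TensorProduct.assoc R W W W p)) := by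
    intro p
    induction p using TensorProduct.induction_on with
    | zero => simp
    | tmul t c =>
      induction t using TensorProduct.induction_on with
      | zero => simp
      | tmul a b => simp [mul_assoc]
      | add a b ha hb => simp only [map_add, TensorProduct.add_tmul, ha, hb]
    | add a b ha hb => simp only [map_add, ha, hb]
  rw [key, coassoc_apply]
  congr 1
  induction H.comul h using TensorProduct.induction_on with
  | zero => simp
  | tmul a b => simp [e]
  | add a b ha hb => simp only [map_add, ha, hb]

variable {H}

lemma IsCounitalL.antipode_mul (hx : H.IsCounitalL x) (h : W) :
    H.antipode (h * x) = H.epsR x * H.antipode h := by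
  rw [antipode_eq_epsR, antipode_eq_epsR H h, hx.comul_mul_right]
  induction H.comul h using TensorProduct.induction_on with
  | zero => simp
  | tmul a b => simp [hx.epsR_mul, mul_assoc]
  | add a b ha hb => simp only [map_add, add_mul, mul_add, ha, hb]

lemma IsCounitalR.antipode_mul (hy : H.IsCounitalR y) (h : W) :
    H.antipode (y * h) = H.antipode h * H.epsL y := by
  rw [antipode_eq_epsL, antipode_eq_epsL H h, hy.comul_mul_left]
  induction H.comul h using TensorProduct.induction_on with
  | zero => simp
  | tmul a b => simp [hy.epsL_mul, mul_assoc]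
  | add a b ha hb => simp only [map_add, add_mul, mul_add, ha, hb]

variable (H)

lemma lTensor_epsL_comul (u : W) :
    H.epsL.lTensor W (H.comul u) = H.comul 1 * (u ⊗ₜ 1) := by
  let m : (W ⊗[R] W) ⊗[R] W →ₗ[R] W ⊗[R] W := (sliceR H.counit).rTensor W
  have h₁ : ∀ t s : W ⊗[R] W,
      m ((TensorProduct.assoc R W W W).symm (1 ⊗ₜ s) * (t ⊗ₜ 1))
        = (TensorProduct.map LinearMap.id
            ((TensorProduct.lid R W).toLinearMap ∘ₗ H.counit.rTensor W ∘ₗ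
              LinearMap.mulLeft R s ∘ₗ (TensorProduct.mk R W W).flip 1)) t := by
    intro t s
    induction t using TensorProduct.induction_on with
    | zero => simp
    | tmul a b =>
      induction s using TensorProduct.induction_on with
      | zero => simp
      | tmul c d => simp [m, TensorProduct.smul_tmul']
      | add c d hc hd =>
        simp only [map_add, TensorProduct.tmul_add, add_mul, hc, hd]
        simp [add_mul, TensorProduct.tmul_add]
    | add a b ha hb => simp only [map_add, TensorProduct.add_tmul, mul_add, ha, hb]
  have h₂ : ∀ t : W ⊗[R] W, m (H.comul.rTensor W t * (H.comul u ⊗ₜ 1)) = t * (u ⊗ₜ 1) := by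
    intro t
    induction t using TensorProduct.induction_on with
    | zero => simp
    | tmul a b => simp [m, ← H.comul_mul, sliceR_counit_comul]
    | add a b ha hb => simp only [map_add, add_mul, ha, hb]
  rw [← h₂, H.weak_comul_one', mul_assoc, Algebra.TensorProduct.tmul_mul_tmul, one_mul,
    comul_one_mul, h₁]
  rfl

lemma lTensor_epsL_comul_one_mul (u : W) :
    H.epsL.lTensor W (H.comul 1 * (1 ⊗ₜ u)) = H.comul 1 * (1 ⊗ₜ H.epsL u) := by
  have e : ∀ v, H.epsL v = LinearMap.mul' R W ((H.antipode.lTensor W) (H.comul v)) :=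
    fun v => (H.antipode_left v).symm
  let E := (LinearMap.mul' R W ∘ₗ H.antipode.lTensor W).lTensor W
  have h₁ : ∀ t : W ⊗[R] W,
      H.epsL.lTensor W (t * (1 ⊗ₜ u)) = E (H.comul.lTensor W t * (1 ⊗ₜ H.comul u)) := by
    intro t
    induction t using TensorProduct.induction_on with
    | zero => simp
    | tmul a b => simp [E, e, H.comul_mul]
    | add a b ha hb => simp only [map_add, add_mul, ha, hb]
  have h₂ : ∀ t s : W ⊗[R] W,
      E (TensorProduct.assoc R W W W (t ⊗ₜ 1) * (1 ⊗ₜ s))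
        = t * (1 ⊗ₜ LinearMap.mul' R W (H.antipode.lTensor W s)) := by
    intro t s
    induction t using TensorProduct.induction_on with
    | zero => simp
    | tmul a b =>
      induction s using TensorProduct.induction_on with
      | zero => simp
      | tmul c d => simp [E, mul_assoc]
      | add c d hc hd => simp only [map_add, TensorProduct.tmul_add, mul_add, hc, hd]
    | add a b ha hb => simp only [map_add, TensorProduct.add_tmul, add_mul, ha, hb]
  rw [h₁, lTensor_comul_comul_one, mul_assoc, Algebra.TensorProduct.tmul_mul_tmul, one_mul,
    comul_one_mul, h₂, e]

variable {H}

lemma IsCounitalR.comul_mul_tmul (hy : H.IsCounitalR y) (u : W) :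
    H.comul u * (y ⊗ₜ 1) = H.comul u * (1 ⊗ₜ H.epsL y) := by
  rw [← comul_mul_one, mul_assoc, mul_assoc, ← lTensor_epsL_comul, hy.comul_eq',
    lTensor_epsL_comul_one_mul]

end General

section Field

variable {k : Type*} {W : Type*} [Field k] [Ring W] [Algebra k W]
  (H : WeakHopf k W) (Sinv : W →ₗ[k] W)

/-- The bilinear map `((a ⊗ b) ⊗ c, t) ↦ b·G(S⁻¹(c)·t·a)` underlying `mulD`. -/
noncomputable def twist (G : W →ₗ[k] W) : (W ⊗[k] W) ⊗[k] W →ₗ[k] W →ₗ[k] W :=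
  TensorProduct.curry
    (LinearMap.mul' k W
      ∘ₗ LinearMap.lTensor W
          (G ∘ₗ LinearMap.mul' k W ∘ₗ LinearMap.rTensor W (LinearMap.mul' k W))
      ∘ₗ (TensorProduct.comm k ((W ⊗[k] W) ⊗[k] W) W).toLinearMap
      ∘ₗ (TensorProduct.assoc k (W ⊗[k] W) W W).symm.toLinearMap
      ∘ₗ (TensorProduct.comm k (W ⊗[k] W) (W ⊗[k] W)).toLinearMap
      ∘ₗ (TensorProduct.assoc k (W ⊗[k] W) W W).toLinearMap
      ∘ₗ LinearMap.rTensor W (LinearMap.lTensor (W ⊗[k] W) Sinv))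

@[simp] lemma twist_tmul (G : W →ₗ[k] W) (a b c t : W) :
    twist Sinv G ((a ⊗ₜ b) ⊗ₜ c) t = b * G (Sinv c * t * a) := by
  simp [twist]

lemma twist_add (F G : W →ₗ[k] W) : twist Sinv (F + G) = twist Sinv F + twist Sinv G := by
  ext; simp [mul_add]

lemma twist_smul (r : k) (F : W →ₗ[k] W) : twist Sinv (r • F) = r • twist Sinv F := by
  ext; simp

lemma twist_sub (F G : W →ₗ[k] W) : twist Sinv (F - G) = twist Sinv F - twist Sinv G := by
  ext; simp [mul_sub]

lemma mulD_eq (F G : W →ₗ[k] W) :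
    H.mulD Sinv F G
      = TensorProduct.lift (twist Sinv G ∘ₗ H.comul.rTensor W ∘ₗ H.comul ∘ₗ F) ∘ₗ H.comul := by
  have key : TensorProduct.lift (twist Sinv G ∘ₗ H.comul.rTensor W ∘ₗ H.comul ∘ₗ F)
      = LinearMap.mul' k W
      ∘ₗ LinearMap.lTensor W
          (G ∘ₗ LinearMap.mul' k W ∘ₗ LinearMap.rTensor W (LinearMap.mul' k W))
      ∘ₗ (TensorProduct.comm k ((W ⊗[k] W) ⊗[k] W) W).toLinearMap
      ∘ₗ (TensorProduct.assoc k (W ⊗[k] W) W W).symm.toLinearMap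
      ∘ₗ (TensorProduct.comm k (W ⊗[k] W) (W ⊗[k] W)).toLinearMap
      ∘ₗ (TensorProduct.assoc k (W ⊗[k] W) W W).toLinearMap
      ∘ₗ LinearMap.rTensor W
          (LinearMap.lTensor (W ⊗[k] W) Sinv ∘ₗ LinearMap.rTensor W H.comul ∘ₗ H.comul ∘ₗ F) := by
    apply TensorProduct.ext'
    intro a b
    simp [twist]
  rw [key]
  rfl

lemma mulD_sub_left (F₁ F₂ G : W →ₗ[k] W) :
    H.mulD Sinv (F₁ - F₂) G = H.mulD Sinv F₁ G - H.mulD Sinv F₂ G := by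
  simp only [mulD_eq]
  rw [← LinearMap.sub_comp]
  congr 1
  exact TensorProduct.ext' (by simp)

lemma mulD_add_left (F₁ F₂ G : W →ₗ[k] W) :
    H.mulD Sinv (F₁ + F₂) G = H.mulD Sinv F₁ G + H.mulD Sinv F₂ G := by
  simp only [mulD_eq]
  rw [← LinearMap.add_comp]
  congr 1
  exact TensorProduct.ext' (by simp)

lemma mulD_smul_left (r : k) (F G : W →ₗ[k] W) :
    H.mulD Sinv (r • F) G = r • H.mulD Sinv F G := by
  simp only [mulD_eq]
  rw [← LinearMap.smul_comp]
  congr 1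
  exact TensorProduct.ext' (by simp)

lemma mulD_rkOne (φ : Module.Dual k W) (h : W) (G : W →ₗ[k] W) (t : W) :
    H.mulD Sinv (rkOne φ h) G t
      = TensorProduct.lid k W (TensorProduct.map φ
          (twist Sinv G (H.comul.rTensor W (H.comul h))) (H.comul t)) := by
  rw [mulD_eq, LinearMap.comp_apply]
  induction H.comul t using TensorProduct.induction_on with
  | zero => simp
  | tmul a b => simp [rkOne]
  | add a b ha hb => simp only [map_add, ha, hb]

lemma map_cmul_comul (φ ψ : Module.Dual k W) (Q : W →ₗ[k] W) (t : W) :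
    TensorProduct.lid k W (TensorProduct.map (H.cmul φ ψ) Q (H.comul t))
      = TensorProduct.lid k W
          (TensorProduct.map φ (Q ∘ₗ sliceL ψ ∘ₗ H.comul) (H.comul t)) := by
  let E : W ⊗[k] (W ⊗[k] W) →ₗ[k] W :=
    (TensorProduct.lid k W).toLinearMap ∘ₗ TensorProduct.map φ (Q ∘ₗ sliceL ψ)
  have h₁ : ∀ s : W ⊗[k] W, TensorProduct.lid k W (TensorProduct.map (H.cmul φ ψ) Q s)
      = E (TensorProduct.assoc k W W W (H.comul.rTensor W s)) := by
    intro s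
    induction s using TensorProduct.induction_on with
    | zero => simp
    | tmul a b =>
      simp only [cmul, TensorProduct.map_tmul, LinearMap.comp_apply, LinearMap.rTensor_tmul,
        TensorProduct.lid_tmul]
      induction H.comul a using TensorProduct.induction_on with
      | zero => simp
      | tmul c d => simp [E, mul_smul, smul_comm (φ c)]
      | add c d hc hd => simp only [map_add, TensorProduct.add_tmul, add_smul, hc, hd]
    | add a b ha hb => simp only [map_add, ha, hb]
  rw [h₁, coassoc_apply]
  induction H.comul t using TensorProduct.induction_on with
  | zero => simp
  | tmul a b => simp [E]
  | add a b ha hb => simp only [map_add, ha, hb]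

/-- If the operator `twist` attaches to `h'` is the one attached to `h` precomposed with
`t ↦ Σ ψ(t⁽¹⁾)t⁽²⁾`, then `φ ⊗ h'` and `φψ ⊗ h` agree as left factors of `mulD`. -/
lemma mulD_rkOne_sub_eq_zero (φ ψ : Module.Dual k W) (h h' : W) (G : W →ₗ[k] W)
    (e : ∀ t, twist Sinv G (H.comul.rTensor W (H.comul h')) t
      = twist Sinv G (H.comul.rTensor W (H.comul h)) (sliceL ψ (H.comul t))) :
    H.mulD Sinv (rkOne φ h' - rkOne (H.cmul φ ψ) h) G = 0 := by
  ext t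
  rw [mulD_sub_left, LinearMap.sub_apply, mulD_rkOne, mulD_rkOne, map_cmul_comul, LinearMap.zero_apply,
    sub_eq_zero]
  congr 3
  ext s
  exact e s

variable {H Sinv} {x y : W}

lemma sliceL_mulRight (x : W) (t : W ⊗[k] W) :
    sliceL (H.counit ∘ₗ LinearMap.mulRight k x) t = sliceL H.counit (t * (x ⊗ₜ 1)) := by
  induction t using TensorProduct.induction_on with
  | zero => simp
  | tmul a b => simp
  | add a b ha hb => simp only [map_add, add_mul, ha, hb]

lemma sliceL_mulLeft (x : W) (t : W ⊗[k] W) :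
    sliceL (H.counit ∘ₗ LinearMap.mulLeft k x) t = sliceL H.counit ((x ⊗ₜ 1) * t) := by
  induction t using TensorProduct.induction_on with
  | zero => simp
  | tmul a b => simp
  | add a b ha hb => simp only [map_add, mul_add, ha, hb]

lemma mul'_map_eq_sliceR (φ ψ : Module.Dual k W) (t : W ⊗[k] W) :
    LinearMap.mul' k k (TensorProduct.map φ ψ t) = φ (sliceR ψ t) := by
  induction t using TensorProduct.induction_on with
  | zero => simp
  | tmul a b => simp [mul_comm]
  | add a b ha hb => simp only [map_add, ha, hb]

lemma mulD_genL_left (hx : H.IsCounitalL x) (φ : Module.Dual k W) (h : W) (G : W →ₗ[k] W) :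
    H.mulD Sinv (rkOne φ (x * h)
      - rkOne (H.cmul φ (H.counit ∘ₗ LinearMap.mulRight k x)) h) G = 0 := by
  apply mulD_rkOne_sub_eq_zero
  intro t
  rw [sliceL_mulRight, ← hx.comul_mul_right, sliceL_counit_comul, hx.comul_mul_left]
  induction H.comul h using TensorProduct.induction_on with
  | zero => simp
  | tmul a b =>
    simp only [Algebra.TensorProduct.tmul_mul_tmul, LinearMap.rTensor_tmul, one_mul,
      hx.comul_mul_left]
    induction H.comul a using TensorProduct.induction_on with
    | zero => simp
    | tmul c d => simp [mul_assoc]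
    | add c d hc hd => simp only [map_add, TensorProduct.add_tmul, mul_add, LinearMap.add_apply,
        hc, hd]
  | add a b ha hb => simp only [map_add, mul_add, LinearMap.add_apply, ha, hb]

lemma mulD_genR_left (hS₁ : Sinv ∘ₗ H.antipode = LinearMap.id)
    (hS₂ : H.antipode ∘ₗ Sinv = LinearMap.id)
    (hx : H.IsCounitalL x) (φ : Module.Dual k W) (h : W) (G : W →ₗ[k] W) :
    H.mulD Sinv (rkOne φ (H.epsR x * h)
      - rkOne (H.cmul φ (H.counit ∘ₗ LinearMap.mulLeft k (H.epsR x))) h) G = 0 := by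
  have hy := H.isCounitalR_epsR x
  have hc : H.counit ∘ₗ LinearMap.mulLeft k (H.epsR x) = H.counit ∘ₗ LinearMap.mulLeft k x :=
    LinearMap.ext fun w => H.counit_epsR_mul x w
  have hS : ∀ u, Sinv (H.epsR x * u) = Sinv u * x := by
    intro u
    have e : H.antipode (Sinv u) = u := LinearMap.congr_fun hS₂ u
    have e' : Sinv (H.antipode (Sinv u * x)) = Sinv u * x := LinearMap.congr_fun hS₁ _
    rwa [hx.antipode_mul, e] at e'
  apply mulD_rkOne_sub_eq_zero
  intro t
  rw [hc, sliceL_mulLeft, ← hx.comul_mul_left, sliceL_counit_comul, hy.comul_mul_left]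
  induction H.comul h using TensorProduct.induction_on with
  | zero => simp
  | tmul a b =>
    simp only [Algebra.TensorProduct.tmul_mul_tmul, LinearMap.rTensor_tmul, one_mul]
    induction H.comul a using TensorProduct.induction_on with
    | zero => simp
    | tmul c d => simp [hS, mul_assoc]
    | add c d hc hd => simp only [map_add, TensorProduct.add_tmul, LinearMap.add_apply, hc, hd]
  | add a b ha hb => simp only [map_add, mul_add, LinearMap.add_apply, ha, hb]

lemma twist_genL (hy : H.IsCounitalR y) (φ : Module.Dual k W) (h g : W) :
    twist Sinv (rkOne φ (H.epsL y * h)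
      - rkOne (H.cmul φ (H.counit ∘ₗ LinearMap.mulRight k (H.epsL y))) h)
        (H.comul.rTensor W (H.comul g)) = 0 := by
  have hc : H.counit ∘ₗ LinearMap.mulRight k (H.epsL y) = H.counit ∘ₗ LinearMap.mulRight k y :=
    LinearMap.ext fun w => H.counit_mul_epsL w y
  have hφ : H.cmul φ (H.counit ∘ₗ LinearMap.mulRight k (H.epsL y))
      = φ ∘ₗ LinearMap.mulRight k y := by
    ext w
    have e : sliceR (H.counit ∘ₗ LinearMap.mulRight k y) (H.comul w)
        = sliceR H.counit (H.comul w * (1 ⊗ₜ y)) := by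
      induction H.comul w using TensorProduct.induction_on with
      | zero => simp
      | tmul a b => simp
      | add a b ha hb => simp only [map_add, add_mul, ha, hb]
    rw [hc, cmul, LinearMap.comp_apply, LinearMap.comp_apply, mul'_map_eq_sliceR, e,
      ← hy.comul_mul_right, sliceR_counit_comul]
    simp
  rw [hφ, twist_sub, LinearMap.sub_apply, sub_eq_zero]
  ext t
  have h₁ : ∀ q : W ⊗[k] W, ∀ c, twist Sinv (rkOne φ (H.epsL y * h)) (q ⊗ₜ c) t
      = twist Sinv (rkOne φ h) ((q * (1 ⊗ₜ H.epsL y)) ⊗ₜ c) t := by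
    intro q c
    induction q using TensorProduct.induction_on with
    | zero => simp
    | tmul a b => simp [rkOne, mul_assoc]
    | add a b ha hb => simp only [map_add, add_mul, TensorProduct.add_tmul, LinearMap.add_apply,
        ha, hb]
  have h₂ : ∀ q : W ⊗[k] W, ∀ c, twist Sinv (rkOne (φ ∘ₗ LinearMap.mulRight k y) h) (q ⊗ₜ c) t
      = twist Sinv (rkOne φ h) ((q * (y ⊗ₜ 1)) ⊗ₜ c) t := by
    intro q c
    induction q using TensorProduct.induction_on with
    | zero => simp
    | tmul a b => simp [rkOne, mul_assoc]
    | add a b ha hb => simp only [map_add, add_mul, TensorProduct.add_tmul, LinearMap.add_apply,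
        ha, hb]
  induction H.comul g using TensorProduct.induction_on with
  | zero => simp
  | tmul a b => rw [LinearMap.rTensor_tmul, h₁, h₂, hy.comul_mul_tmul]
  | add a b ha hb => simp only [map_add, LinearMap.add_apply, ha, hb]

lemma twist_genR (hS₁ : Sinv ∘ₗ H.antipode = LinearMap.id)
    (hS₂ : H.antipode ∘ₗ Sinv = LinearMap.id)
    (hy : H.IsCounitalR y) (φ : Module.Dual k W) (h g : W) :
    twist Sinv (rkOne φ (y * h)
      - rkOne (H.cmul φ (H.counit ∘ₗ LinearMap.mulLeft k y)) h)
        (H.comul.rTensor W (H.comul g)) = 0 := by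
  have hS : ∀ u, y * Sinv u = Sinv (u * H.epsL y) := by
    intro u
    have e : H.antipode (Sinv u) = u := LinearMap.congr_fun hS₂ u
    have e' : Sinv (H.antipode (y * Sinv u)) = y * Sinv u := LinearMap.congr_fun hS₁ _
    rw [hy.antipode_mul, e] at e'
    exact e'.symm
  have hφ : H.cmul φ (H.counit ∘ₗ LinearMap.mulLeft k y) = φ ∘ₗ LinearMap.mulLeft k y := by
    ext w
    have e : sliceR (H.counit ∘ₗ LinearMap.mulLeft k y) (H.comul w)
        = sliceR H.counit ((1 ⊗ₜ y) * H.comul w) := by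
      induction H.comul w using TensorProduct.induction_on with
      | zero => simp
      | tmul a b => simp
      | add a b ha hb => simp only [map_add, mul_add, ha, hb]
    rw [cmul, LinearMap.comp_apply, LinearMap.comp_apply, mul'_map_eq_sliceR, e,
      ← hy.comul_mul_left, sliceR_counit_comul]
    simp
  rw [hφ, twist_sub, LinearMap.sub_apply, sub_eq_zero]
  ext t
  have h₁ : ∀ a : W, ∀ q : W ⊗[k] W, twist Sinv (rkOne φ (y * h))
        ((TensorProduct.assoc k W W W).symm (a ⊗ₜ q)) t
      = twist Sinv (rkOne φ h)
        ((TensorProduct.assoc k W W W).symm (a ⊗ₜ (q * (y ⊗ₜ 1)))) t := by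
    intro a q
    induction q using TensorProduct.induction_on with
    | zero => simp
    | tmul b c => simp [rkOne, mul_assoc]
    | add b c hb hc => simp only [map_add, add_mul, TensorProduct.tmul_add, LinearMap.add_apply,
        hb, hc]
  have h₂ : ∀ a : W, ∀ q : W ⊗[k] W, twist Sinv (rkOne (φ ∘ₗ LinearMap.mulLeft k y) h)
        ((TensorProduct.assoc k W W W).symm (a ⊗ₜ q)) t
      = twist Sinv (rkOne φ h)
        ((TensorProduct.assoc k W W W).symm (a ⊗ₜ (q * (1 ⊗ₜ H.epsL y)))) t := by
    intro a q
    induction q using TensorProduct.induction_on with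
    | zero => simp
    | tmul b c => simp [rkOne, ← hS, mul_assoc]
    | add b c hb hc => simp only [map_add, add_mul, TensorProduct.tmul_add, LinearMap.add_apply,
        hb, hc]
  rw [← (TensorProduct.assoc k W W W).symm_apply_apply (H.comul.rTensor W (H.comul g)),
    coassoc_apply]
  induction H.comul g using TensorProduct.induction_on with
  | zero => simp
  | tmul a b => rw [LinearMap.lTensor_tmul, h₁, h₂, hy.comul_mul_tmul]
  | add a b ha hb => simp only [map_add, LinearMap.add_apply, ha, hb]

/-- Every element of `J` annihilates `Ŵ^{cop} ⊗ W` from the left. -/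
lemma mulD_eq_zero_of_mem_left (hS₁ : Sinv ∘ₗ H.antipode = LinearMap.id)
    (hS₂ : H.antipode ∘ₗ Sinv = LinearMap.id) {F : W →ₗ[k] W} (hF : F ∈ Jideal H)
    (G : W →ₗ[k] W) : H.mulD Sinv F G = 0 := by
  induction hF using Submodule.span_induction with
  | mem F hF =>
    rcases hF with ⟨φ, _, h, ⟨u, rfl⟩, rfl⟩ | ⟨φ, _, h, ⟨u, rfl⟩, rfl⟩
    · exact mulD_genL_left (H.isCounitalL_epsL u) φ h G
    · obtain ⟨x, hx, e⟩ := H.exists_epsR_eq u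
      rw [← e]
      exact mulD_genR_left hS₁ hS₂ hx φ h G
  | zero => rw [← zero_smul k (0 : W →ₗ[k] W), mulD_smul_left, zero_smul, zero_smul]
  | add F₁ F₂ _ _ h₁ h₂ => rw [mulD_add_left, h₁, h₂, add_zero]
  | smul r F _ h => rw [mulD_smul_left, h, smul_zero]

/-- Every element of `J` annihilates `Ŵ^{cop} ⊗ W` from the right. -/
lemma mulD_eq_zero_of_mem_right (hS₁ : Sinv ∘ₗ H.antipode = LinearMap.id)
    (hS₂ : H.antipode ∘ₗ Sinv = LinearMap.id) {F : W →ₗ[k] W} (hF : F ∈ Jideal H)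
    (G : W →ₗ[k] W) : H.mulD Sinv G F = 0 := by
  have key : ∀ g, twist Sinv F (H.comul.rTensor W (H.comul g)) = 0 := by
    intro g
    induction hF using Submodule.span_induction with
    | mem F hF =>
      rcases hF with ⟨φ, _, h, ⟨u, rfl⟩, rfl⟩ | ⟨φ, _, h, ⟨u, rfl⟩, rfl⟩
      · obtain ⟨y, hy, e⟩ := H.exists_epsL_eq u
        rw [← e]
        exact twist_genL hy φ h g
      · exact twist_genR hS₁ hS₂ (H.isCounitalR_epsR u) φ h g
    | zero => rw [← zero_smul k (0 : W →ₗ[k] W), twist_smul, zero_smul, LinearMap.zero_apply, zero_smul]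
    | add F₁ F₂ _ _ h₁ h₂ => rw [twist_add, LinearMap.add_apply, h₁, h₂, add_zero]
    | smul r F _ h => rw [twist_smul, LinearMap.smul_apply, h, smul_zero]
  rw [mulD_eq]
  have hz : twist Sinv F ∘ₗ H.comul.rTensor W ∘ₗ H.comul ∘ₗ G = 0 :=
    LinearMap.ext fun g => key (G g)
  rw [hz, TensorProduct.ext' (g := TensorProduct.lift 0) (h := 0) (by simp), LinearMap.zero_comp]

end Field

end WeakHopf

/-- The linear span `J` of the elements `φ⊗xh − φ(x⇀ε)⊗h` (`x ∈ W_L`) and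
`φ⊗yh − φ(ε↼y)⊗h` (`y ∈ W_R`) is a two-sided ideal of `Ŵ^{cop} ⊗ W` equipped with the
multiplication `(φ⊗h)(ψ⊗g) = Σ φψ⁽²⁾ ⊗ h⁽²⁾g ⟨ψ⁽¹⁾,S⁻¹(h⁽³⁾)⟩⟨ψ⁽³⁾,h⁽¹⁾⟩`
(realized here in operator form, see `WeakHopf.mulD`). -/
theorem Jideal_two_sided {k : Type*} {W : Type*} [Field k] [Ring W] [Algebra k W]
    (H : WeakHopf k W) (Sinv : W →ₗ[k] W)
    (hS₁ : Sinv ∘ₗ H.antipode = LinearMap.id) (hS₂ : H.antipode ∘ₗ Sinv = LinearMap.id) :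
    ∀ F ∈ WeakHopf.Jideal H, ∀ G : W →ₗ[k] W,
      H.mulD Sinv G F ∈ WeakHopf.Jideal H ∧ H.mulD Sinv F G ∈ WeakHopf.Jideal H := by
  intro F hF G
  rw [WeakHopf.mulD_eq_zero_of_mem_right hS₁ hS₂ hF, WeakHopf.mulD_eq_zero_of_mem_left hS₁ hS₂ hF]
  exact ⟨Submodule.zero_mem _, Submodule.zero_mem _⟩
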